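/- Let m ≥ 2, d ≥ 1 with d(m−1) ≥ 2, and let μ^{(m)} denote the m-fold convolution of the parabolic measure μ on ℝ × ℝ^d (where μ is the pushforward of Lebesgue measure under ζ ↦ (|ζ|²,ζ)). Then μ^{(m)} is absolutely continuous on the region σ > |ζ|²/m with density dμ^{(m)}(σ,ζ) = (|S^{(m−1)d−1}| / (2 m^{d/2})) · (σ − |ζ|²/m)^{(d(m−1)−2)/2}. -/

import Mathlib

open MeasureTheory
open scoped BigOperators

/-- Surface area of the unit sphere S^{n-1} in ℝ^n: |S^{n−1}| = 2π^{n/2}/Γ(n/2). -/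
noncomputable def sphereArea (n : ℕ) : ℝ :=
  2 * Real.pi ^ ((n : ℝ) / 2) / Real.Gamma ((n : ℝ) / 2)

lemma aux_curry (m d : ℕ) :
    MeasurePreserving (fun η : Fin m → EuclideanSpace ℝ (Fin d) =>
      (WithLp.toLp 2 (fun p : Fin m × Fin d => η p.1 p.2) :
        EuclideanSpace ℝ (Fin m × Fin d))) volume volume := by
  have h1 : MeasurePreserving (fun (η : Fin m → EuclideanSpace ℝ (Fin d)) (j : Fin m) =>
      (WithLp.ofLp (η j) : Fin d → ℝ)) volume volume :=
    volume_preserving_pi (fun _ => PiLp.volume_preserving_ofLp (Fin d))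
  have h2 : MeasurePreserving (fun (η : Fin m → Fin d → ℝ) (p : Fin m × Fin d) =>
      η p.1 p.2) volume volume := by
    refine ⟨by fun_prop, ?_⟩
    symm
    refine Measure.pi_eq fun s hs => ?_
    rw [Measure.map_apply (by fun_prop) (MeasurableSet.univ_pi hs)]
    have : (fun (η : Fin m → Fin d → ℝ) (p : Fin m × Fin d) => η p.1 p.2) ⁻¹' Set.univ.pi s
        = Set.univ.pi (fun j => Set.univ.pi (fun i => s (j, i))) := by
      ext η; simp [Set.mem_pi]
    rw [this, volume_pi_pi, Fintype.prod_prod_type]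
    simp_rw [volume_pi_pi]
  exact (PiLp.volume_preserving_toLp (Fin m × Fin d)).comp (h2.comp h1)

lemma aux_polar {F : Type*} [NormedAddCommGroup F] [InnerProductSpace ℝ F]
    [FiniteDimensional ℝ F] [MeasurableSpace F] [BorelSpace F] [Nontrivial F]
    (f : ℝ → ENNReal) (hf : Measurable f) :
    ∫⁻ x : F, f ‖x‖ = (Module.finrank ℝ F * volume (Metric.ball (0 : F) 1)) *
      ∫⁻ y in Set.Ioi (0 : ℝ), ENNReal.ofReal (y ^ (Module.finrank ℝ F - 1)) * f y :=
  calc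
    ∫⁻ x : F, f ‖x‖ = ∫⁻ x : ({(0)}ᶜ : Set F), f (‖x.1‖) ∂((volume : Measure F).comap Subtype.val) := by
      rw [lintegral_subtype_comap (measurableSet_singleton _).compl fun x ↦ f (‖x‖),
        restrict_compl_singleton]
    _ = ∫⁻ x, f x.2 ∂(volume : Measure F).toSphere.prod (.volumeIoiPow (Module.finrank ℝ F - 1)) := by
      simpa using (volume : Measure F).measurePreserving_homeomorphUnitSphereProd.lintegral_comp_emb
        (Homeomorph.measurableEmbedding _) (f ∘ Subtype.val ∘ Prod.snd)
    _ = (volume : Measure F).toSphere Set.univ *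
        ∫⁻ x : Set.Ioi (0 : ℝ), f x ∂.volumeIoiPow (Module.finrank ℝ F - 1) := by
      rw [lintegral_prod _ (by fun_prop)]
      simp [mul_comm]
    _ = _ := by
      rw [Measure.toSphere_apply_univ]
      congr 1
      rw [Measure.volumeIoiPow, lintegral_withDensity_eq_lintegral_mul _ (by fun_prop) (by fun_prop)]
      exact lintegral_subtype_comap measurableSet_Ioi
        fun a : ℝ ↦ ENNReal.ofReal (a ^ (Module.finrank ℝ F - 1)) * f a

lemma aux_const (n : ℕ) (hn : 1 ≤ n) :
    (n : ℝ) * (√Real.pi ^ n / Real.Gamma (n / 2 + 1)) = sphereArea n := by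
  have h0 : (0 : ℝ) < n := by exact_mod_cast hn
  have h1 : √Real.pi ^ n = Real.pi ^ ((n : ℝ) / 2) := by
    rw [Real.sqrt_eq_rpow, ← Real.rpow_natCast, ← Real.rpow_mul Real.pi_pos.le]
    congr 1; ring
  have h2 := Real.Gamma_pos_of_pos (half_pos h0)
  rw [sphereArea, h1, Real.Gamma_add_one (by positivity)]
  field_simp

lemma aux_radial {F : Type*} [NormedAddCommGroup F] [InnerProductSpace ℝ F]
    [FiniteDimensional ℝ F] [MeasurableSpace F] [BorelSpace F] (n : ℕ) (hn : 2 ≤ n)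
    (hF : Module.finrank ℝ F = n)
    (f : ℝ → ENNReal) (hf : Measurable f) :
    ∫⁻ x : F, f (‖x‖ ^ 2) =
      ∫⁻ s in Set.Ioi (0 : ℝ),
        ENNReal.ofReal (sphereArea n / 2 * s ^ (((n : ℝ) - 2) / 2)) * f s := by
  have : Nontrivial F := Module.nontrivial_of_finrank_pos (R := ℝ) (by omega)
  have hA : 0 ≤ sphereArea n := by
    rw [← aux_const n (by omega)]
    have : 0 < Real.Gamma ((n : ℝ) / 2 + 1) := Real.Gamma_pos_of_pos (by positivity)
    positivity
  rw [aux_polar (fun y => f (y ^ 2)) (by fun_prop), InnerProductSpace.volume_ball, hF]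
  have hc : (n : ENNReal) * (ENNReal.ofReal 1 ^ n *
      ENNReal.ofReal (√Real.pi ^ n / Real.Gamma (n / 2 + 1))) = ENNReal.ofReal (sphereArea n) := by
    rw [ENNReal.ofReal_one, one_pow, one_mul, ← ENNReal.ofReal_natCast,
      ← ENNReal.ofReal_mul (by positivity), aux_const n (by omega)]
  rw [hc]
  have him : (fun y : ℝ => y ^ 2) '' Set.Ioi 0 = Set.Ioi 0 := by
    ext s
    constructor
    · rintro ⟨y, hy, rfl⟩
      exact pow_pos (Set.mem_Ioi.1 hy) 2
    · intro hs
      exact ⟨√s, Real.sqrt_pos.2 hs, Real.sq_sqrt (le_of_lt hs)⟩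
  conv_rhs => rw [← him]
  rw [lintegral_image_eq_lintegral_abs_deriv_mul (f' := fun y => 2 * y) measurableSet_Ioi
    (fun x _ => by simpa using (hasDerivAt_pow 2 x).hasDerivWithinAt)
    (fun a ha b hb h => (pow_left_inj₀ (le_of_lt ha) (le_of_lt hb) two_ne_zero).1 h)]
  rw [← lintegral_const_mul _ (by fun_prop)]
  refine setLIntegral_congr_fun measurableSet_Ioi fun y hy => ?_
  have hy' : 0 < y := hy
  rw [← mul_assoc, ← mul_assoc, ← ENNReal.ofReal_mul hA, ← ENNReal.ofReal_mul (by positivity)]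
  congr 2
  rw [← Real.rpow_natCast y 2, ← Real.rpow_mul hy'.le, abs_of_pos (by positivity)]
  have e1 : ((2 : ℕ) : ℝ) * (((n : ℝ) - 2) / 2) = ((n - 2 : ℕ) : ℝ) := by
    push_cast [hn]; ring
  rw [e1, Real.rpow_natCast]
  obtain ⟨k, rfl⟩ := Nat.exists_eq_add_of_le hn
  rw [show 2 + k - 1 = k + 1 by omega, show 2 + k - 2 = k by omega]
  ring

/-- The sum map. -/
noncomputable def auxSum (m d : ℕ) :
    EuclideanSpace ℝ (Fin m × Fin d) →ₗ[ℝ] EuclideanSpace ℝ (Fin d) where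
  toFun w := WithLp.toLp 2 (fun i => ∑ j, w (j, i))
  map_add' a b := by ext i; simp [Finset.sum_add_distrib]
  map_smul' c a := by ext i; simp [Finset.mul_sum]

/-- The normalised diagonal map. -/
noncomputable def auxDiag (m d : ℕ) :
    EuclideanSpace ℝ (Fin d) →ₗ[ℝ] EuclideanSpace ℝ (Fin m × Fin d) where
  toFun x := WithLp.toLp 2 (fun p => (√(m : ℝ))⁻¹ * x p.2)
  map_add' a b := by ext i; simp [mul_add]
  map_smul' c a := by ext i; simp; ring

lemma aux_sum_diag (m d : ℕ) (hm : 2 ≤ m) (x : EuclideanSpace ℝ (Fin d)) :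
    auxSum m d (auxDiag m d x) = √(m : ℝ) • x := by
  have h0 : (0 : ℝ) < m := by exact_mod_cast (by omega : 0 < m)
  ext i
  simp only [auxSum, auxDiag, LinearMap.coe_mk, AddHom.coe_mk, Finset.sum_const, Finset.card_univ,
    Fintype.card_fin, nsmul_eq_mul, PiLp.smul_apply, smul_eq_mul]
  rw [← mul_assoc, ← div_eq_mul_inv, Real.div_sqrt]

lemma aux_norm_diag (m d : ℕ) (hm : 2 ≤ m) (x : EuclideanSpace ℝ (Fin d)) :
    ‖auxDiag m d x‖ ^ 2 = ‖x‖ ^ 2 := by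
  have h0 : (0 : ℝ) < m := by exact_mod_cast (by omega : 0 < m)
  rw [EuclideanSpace.real_norm_sq_eq, EuclideanSpace.real_norm_sq_eq, Fintype.sum_prod_type]
  simp only [auxDiag, LinearMap.coe_mk, AddHom.coe_mk, Finset.sum_const, Finset.card_univ,
    Fintype.card_fin, nsmul_eq_mul, mul_pow, inv_pow, Real.sq_sqrt h0.le, ← Finset.mul_sum]
  field_simp

lemma aux_inner_diag (m d : ℕ) (k : EuclideanSpace ℝ (Fin m × Fin d))
    (hk : auxSum m d k = 0) (x : EuclideanSpace ℝ (Fin d)) :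
    inner ℝ k (auxDiag m d x) = 0 := by
  have hk' : ∀ i, ∑ j, k (j, i) = 0 := fun i => by
    have := congrArg (fun v : EuclideanSpace ℝ (Fin d) => v i) hk
    simpa [auxSum] using this
  rw [PiLp.inner_apply, Fintype.sum_prod_type, Finset.sum_comm]
  simp only [auxDiag, LinearMap.coe_mk, AddHom.coe_mk, RCLike.inner_apply, conj_trivial,
    ← Finset.mul_sum, hk', mul_zero, Finset.sum_const_zero]

lemma aux_finrank_ker (m d : ℕ) (hm : 2 ≤ m) :
    Module.finrank ℝ (LinearMap.ker (auxSum m d)) = (m - 1) * d := by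
  have h0 : (0 : ℝ) < m := by exact_mod_cast (by omega : 0 < m)
  have hs : LinearMap.range (auxSum m d) = ⊤ := by
    rw [LinearMap.range_eq_top]
    intro y
    refine ⟨auxDiag m d ((√(m : ℝ))⁻¹ • y), ?_⟩
    rw [aux_sum_diag m d hm, smul_smul, mul_inv_cancel₀ (Real.sqrt_pos.2 h0).ne', one_smul]
  have := LinearMap.finrank_range_add_finrank_ker (auxSum m d)
  rw [hs, finrank_top] at this
  simp only [finrank_euclideanSpace, Fintype.card_prod, Fintype.card_fin] at this
  rw [Nat.sub_mul]
  omega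

/-- The isometry. -/
noncomputable def auxIso (m d : ℕ) (hm : 2 ≤ m) :
    WithLp 2 (LinearMap.ker (auxSum m d) × EuclideanSpace ℝ (Fin d)) →ₗᵢ[ℝ]
      EuclideanSpace ℝ (Fin m × Fin d) where
  toFun p := (p.fst : EuclideanSpace ℝ (Fin m × Fin d)) + auxDiag m d p.snd
  map_add' a b := by simp; abel
  map_smul' c a := by simp
  norm_map' p := by
    rw [← sq_eq_sq₀ (norm_nonneg _) (norm_nonneg _), WithLp.prod_norm_sq_eq_of_L2]
    simp only [LinearMap.coe_mk, AddHom.coe_mk]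
    rw [norm_add_sq_real, aux_inner_diag m d _ p.fst.2, aux_norm_diag m d hm]
    simp

lemma aux_iso_mp (m d : ℕ) (hm : 2 ≤ m) :
    MeasurePreserving (fun p : LinearMap.ker (auxSum m d) × EuclideanSpace ℝ (Fin d) =>
      auxIso m d hm (WithLp.toLp 2 p)) volume volume := by
  have hfr : Module.finrank ℝ (WithLp 2 (LinearMap.ker (auxSum m d) × EuclideanSpace ℝ (Fin d)))
      = Module.finrank ℝ (EuclideanSpace ℝ (Fin m × Fin d)) := by
    rw [(WithLp.linearEquiv 2 ℝ _).finrank_eq, Module.finrank_prod, aux_finrank_ker m d hm]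
    simp only [finrank_euclideanSpace, Fintype.card_prod, Fintype.card_fin]
    obtain ⟨k, rfl⟩ := Nat.exists_eq_add_of_le hm
    rw [show 2 + k - 1 = k + 1 by omega]; ring
  have h1 := ((auxIso m d hm).toLinearIsometryEquiv hfr).measurePreserving
  exact h1.comp (WithLp.volume_preserving_toLp _ _)

lemma aux_iso_norm (m d : ℕ) (hm : 2 ≤ m)
    (p : LinearMap.ker (auxSum m d) × EuclideanSpace ℝ (Fin d)) :
    ‖auxIso m d hm (WithLp.toLp 2 p)‖ ^ 2 = ‖p.1‖ ^ 2 + ‖p.2‖ ^ 2 := by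
  rw [LinearIsometry.norm_map, WithLp.prod_norm_sq_eq_of_L2]
  rfl

lemma aux_iso_sum (m d : ℕ) (hm : 2 ≤ m)
    (p : LinearMap.ker (auxSum m d) × EuclideanSpace ℝ (Fin d)) :
    auxSum m d (auxIso m d hm (WithLp.toLp 2 p)) = √(m : ℝ) • p.2 := by
  change auxSum m d ((p.1 : EuclideanSpace ℝ (Fin m × Fin d)) + auxDiag m d p.2) = _
  rw [map_add, aux_sum_diag m d hm, LinearMap.mem_ker.1 p.1.2, zero_add]

lemma aux_map (m d : ℕ) (hm : 2 ≤ m) :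
    Measure.map (fun η : Fin m → EuclideanSpace ℝ (Fin d) =>
          ((∑ j, ‖η j‖ ^ 2 : ℝ), ∑ j, η j)) volume =
    Measure.map (fun p : LinearMap.ker (auxSum m d) × EuclideanSpace ℝ (Fin d) =>
      (‖p.1‖ ^ 2 + ‖p.2‖ ^ 2, √(m : ℝ) • p.2)) volume := by
  have hc : Measurable (fun w : EuclideanSpace ℝ (Fin m × Fin d) => (‖w‖ ^ 2, auxSum m d w)) :=
    Continuous.measurable (by
      have := (auxSum m d).continuous_of_finiteDimensional
      fun_prop)
  trans Measure.map (fun w : EuclideanSpace ℝ (Fin m × Fin d) => (‖w‖ ^ 2, auxSum m d w)) volume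
  · rw [← (aux_curry m d).map_eq, Measure.map_map hc (aux_curry m d).measurable]
    congr 1
    ext1 η
    simp only [Function.comp]
    congr 1
    · rw [EuclideanSpace.real_norm_sq_eq, Fintype.sum_prod_type]
      simp_rw [EuclideanSpace.real_norm_sq_eq]
    · ext i
      simp [auxSum]
  · rw [← (aux_iso_mp m d hm).map_eq, Measure.map_map hc (aux_iso_mp m d hm).measurable]
    congr 1
    ext1 p
    simp only [Function.comp]
    rw [aux_iso_norm, aux_iso_sum]

/-- The m-fold convolution μ^{(m)} of the parabolic measure μ on ℝ × ℝ^d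
(μ = pushforward of Lebesgue measure under ζ ↦ (|ζ|²,ζ)), realised as the
pushforward of Lebesgue measure on (ℝ^d)^m under η ↦ (∑|η_j|², ∑η_j), is
absolutely continuous on {σ > |ζ|²/m} with density
(|S^{(m−1)d−1}|/(2 m^{d/2})) (σ − |ζ|²/m)^{(d(m−1)−2)/2}. -/
theorem parabolic_convolution_density (d m : ℕ) (hm : 2 ≤ m) (hd : 1 ≤ d)
    (hdm : 2 ≤ d * (m - 1)) :
    (Measure.map
        (fun η : Fin m → EuclideanSpace ℝ (Fin d) =>
          ((∑ j, ‖η j‖ ^ 2 : ℝ), ∑ j, η j))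
        volume).restrict
      {p : ℝ × EuclideanSpace ℝ (Fin d) | ‖p.2‖ ^ 2 / m < p.1}
    = ((volume : Measure (ℝ × EuclideanSpace ℝ (Fin d))).withDensity
        (fun p => ENNReal.ofReal
          (sphereArea ((m - 1) * d) / (2 * (m : ℝ) ^ ((d : ℝ) / 2))
            * (p.1 - ‖p.2‖ ^ 2 / m) ^ (((d * (m - 1) : ℝ) - 2) / 2)))).restrict
      {p : ℝ × EuclideanSpace ℝ (Fin d) | ‖p.2‖ ^ 2 / m < p.1} := by
  have h0 : (0 : ℝ) < m := by exact_mod_cast (by omega : 0 < m)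
  have hsq : 0 < √(m : ℝ) := Real.sqrt_pos.2 h0
  set n := (m - 1) * d with hn
  have hn2 : 2 ≤ n := by rw [hn, mul_comm]; exact hdm
  have hexp : ((d * (m - 1) : ℝ) - 2) / 2 = ((n : ℝ) - 2) / 2 := by
    rw [hn]; push_cast [show 1 ≤ m by omega]; ring
  rw [hexp, aux_map m d hm]
  have hS : MeasurableSet {p : ℝ × EuclideanSpace ℝ (Fin d) | ‖p.2‖ ^ 2 / m < p.1} :=
    measurableSet_lt (by fun_prop) (by fun_prop)
  ext A hA
  rw [Measure.restrict_apply hA, Measure.restrict_apply hA, withDensity_apply _ (hA.inter hS)]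
  set B := A ∩ {p : ℝ × EuclideanSpace ℝ (Fin d) | ‖p.2‖ ^ 2 / m < p.1} with hB
  have hBm : MeasurableSet B := hA.inter hS
  -- the indicator
  let χ : ℝ × EuclideanSpace ℝ (Fin d) → ENNReal := B.indicator 1
  have hχ : Measurable χ := measurable_one.indicator hBm
  have hχ0 : ∀ σ ζ, σ ≤ ‖ζ‖ ^ 2 / m → χ (σ, ζ) = 0 := by
    intro σ ζ h
    refine Set.indicator_of_notMem (fun h' => ?_) _
    exact absurd h'.2 (not_lt.2 h)
  let h : ℝ → ENNReal := fun s => ENNReal.ofReal (sphereArea n / 2 * s ^ (((n : ℝ) - 2) / 2))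
  have hh : Measurable h := by fun_prop
  let G : EuclideanSpace ℝ (Fin d) → ENNReal := fun ζ =>
    ∫⁻ σ : ℝ, h (σ - ‖ζ‖ ^ 2 / m) * χ (σ, ζ)
  have hG : Measurable G := by
    refine Measurable.lintegral_prod_left' (f := fun q : ℝ × EuclideanSpace ℝ (Fin d) =>
      h (q.1 - ‖q.2‖ ^ 2 / m) * χ q) ?_
    fun_prop
  have hL : (Measure.map (fun p : LinearMap.ker (auxSum m d) × EuclideanSpace ℝ (Fin d) =>
      (‖p.1‖ ^ 2 + ‖p.2‖ ^ 2, √(m : ℝ) • p.2)) volume) B = ∫⁻ x, G (√(m : ℝ) • x) := by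
    rw [← lintegral_indicator_one hBm]
    change ∫⁻ a, χ a ∂_ = _
    rw [lintegral_map hχ (by fun_prop)]
    rw [Measure.volume_eq_prod, lintegral_prod_symm' _ (by fun_prop)]
    refine lintegral_congr fun x => ?_
    simp only []
    rw [aux_radial n hn2 (aux_finrank_ker m d hm) (fun s => χ (s + ‖x‖ ^ 2, √(m : ℝ) • x))
      (by fun_prop)]
    have hx : ‖√(m : ℝ) • x‖ ^ 2 / m = ‖x‖ ^ 2 := by
      rw [norm_smul, mul_pow, Real.norm_eq_abs, sq_abs, Real.sq_sqrt h0.le]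
      field_simp
    simp only [G, hx]
    rw [← lintegral_add_right_eq_self (μ := volume)
      (fun σ => h (σ - ‖x‖ ^ 2) * χ (σ, √(m : ℝ) • x)) (‖x‖ ^ 2), ← lintegral_indicator measurableSet_Ioi]
    refine lintegral_congr fun s => ?_
    rw [add_sub_cancel_right]
    by_cases hs : 0 < s
    · rw [Set.indicator_of_mem (Set.mem_Ioi.2 hs)]
    · rw [Set.indicator_of_notMem (by simpa using hs), hχ0, mul_zero]
      rw [hx]; linarith
  rw [hL]
  have hsm : ∫⁻ x, G (√(m : ℝ) • x) =
      ENNReal.ofReal ((m : ℝ) ^ ((d : ℝ) / 2))⁻¹ * ∫⁻ x, G x := by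
    rw [← lintegral_map hG (by fun_prop : Measurable
      (fun x : EuclideanSpace ℝ (Fin d) => √(m : ℝ) • x)),
      Measure.map_addHaar_smul _ hsq.ne', lintegral_smul_measure, smul_eq_mul]
    congr 2
    rw [finrank_euclideanSpace, Fintype.card_fin, abs_of_pos (by positivity), Real.sqrt_eq_rpow,
      ← Real.rpow_natCast, ← Real.rpow_mul h0.le]
    congr 2; ring
  rw [hsm, ← lintegral_indicator hBm, Measure.volume_eq_prod, lintegral_prod_symm',
    ← lintegral_const_mul _ hG]
  · refine lintegral_congr fun ζ => ?_
    simp only [G]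
    rw [← lintegral_const_mul _ (by fun_prop)]
    refine lintegral_congr fun σ => ?_
    by_cases hb : (σ, ζ) ∈ B
    · rw [Set.indicator_of_mem hb]
      simp only [χ, h]
      rw [Set.indicator_of_mem hb, Pi.one_apply, mul_one, ← ENNReal.ofReal_mul (by positivity)]
      congr 1
      rw [← mul_assoc]
      congr 1
      field_simp
    · rw [Set.indicator_of_notMem hb]
      simp only [χ]
      rw [Set.indicator_of_notMem hb, mul_zero, mul_zero]
  · exact Measurable.indicator (by fun_prop) hBm
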